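/- Let L be a finite simplicial complex on vertex set V, k a field of characteristic p (p = 0 or a prime), m : V → ℤ weights with gcd 1 determining χ: G_L ↠ ℤ, Λ = k[t, t^{−1}], and γ_v = t^{m_v} − 1. Fix r ≥ 1. Then the Λ-modules H_i(C_•(T_L, Λ_γ)) for all i ≤ r have trivial ℤ-action (i.e., t·x = x for every element x, equivalently each is a finite direct sum of copies of Λ/(t−1)Λ) if and only if: (†) β_i(k⟨L⟩, V_p(χ)) = 0 for all 1 ≤ i ≤ r, and (‡) β_i(k⟨L⟩, V_q(χ)) = 0 for every prime q ∈ P(χ) with q ≠ p and all 1 ≤ i ≤ r. -/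

import Mathlib

open Finset

variable {V : Type} [Fintype V] [LinearOrder V]

/-- The set of faces of cardinality `c` of a finite family of finsets `L`
(for a simplicial complex, these index the `(c-1)`-simplices, with the empty
simplex corresponding to `c = 0`). -/
abbrev Face (L : Finset (Finset V)) (c : ℕ) := {σ : Finset V // σ ∈ L ∧ σ.card = c}

/-- `L` is (the face set of) a finite abstract simplicial complex:  it contains the
empty face and is closed under passing to subsets. -/
def IsCx (L : Finset (Finset V)) : Prop :=
  ∅ ∈ L ∧ ∀ σ ∈ L, ∀ τ ⊆ σ, τ ∈ L

/-- Incidence coefficient between a face `τ` and a face `σ` (intended: `τ ⊆ σ` with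
`|σ| = |τ| + 1`), twisted by the weights `z`:  if `σ = τ ∪ {v}` this is
`(-1)^{#{w ∈ τ : w < v}} ⬝ z v`, and `0` if `τ ⊄ σ`. -/
def coeffD {R : Type} [CommRing R] (z : V → R) (τ σ : Finset V) : R :=
  if τ ⊆ σ then ∑ v ∈ σ \ τ, (-1 : R) ^ (τ.filter (fun w => w < v)).card * z v else 0

/-- The boundary map `∂^z : C_{c+1}(T_L, R_z) → C_c(T_L, R_z)` of the twisted cellular
chain complex of the toric complex `T_L`:  on a basis element `c_σ`,
`σ = {v_1 < ⋯ < v_{c+1}}`, it is `∂^z c_σ = ∑ (-1)^{r-1} z_{v_r} c_{σ ∖ {v_r}}`. -/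
noncomputable def tB (R : Type) [CommRing R] (L : Finset (Finset V)) (z : V → R) (c : ℕ) :
    (Face L (c+1) → R) →ₗ[R] (Face L c → R) :=
  Matrix.mulVecLin (fun (τ : Face L c) (σ : Face L (c+1)) => coeffD z τ.1 σ.1)

/-- The Aomoto differential on the exterior Stanley--Reisner ring `k⟨L⟩`:  the degree-`c`
piece of `k⟨L⟩` has basis the faces of cardinality `c`, and right multiplication by
`z = ∑ z_v v*` sends the monomial `e_τ` to `∑_{v : τ ∪ {v} ∈ L} ± z_v e_{τ ∪ {v}}`. -/
noncomputable def aD (k : Type) [Field k] (L : Finset (Finset V)) (z : V → k) (c : ℕ) :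
    (Face L c → k) →ₗ[k] (Face L (c+1) → k) :=
  Matrix.mulVecLin (fun (σ : Face L (c+1)) (τ : Face L c) => coeffD z τ.1 σ.1)

/-- The Aomoto--Betti number `β_i(k⟨L⟩, z)`, the dimension of the `i`-th cohomology
of the Aomoto complex `(k⟨L⟩, ·z)`. -/
noncomputable def aomotoBetti (k : Type) [Field k] (L : Finset (Finset V)) (z : V → k)
    (i : ℕ) : ℕ :=
  Module.finrank k (LinearMap.ker (aD k L z i)) -
    (match i with
     | 0 => 0
     | j+1 => Module.finrank k (LinearMap.range (aD k L z j)))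

/-- The canonical degree-one element `z_W = ∑_{v ∈ W} v*` of `k⟨L⟩`, as a weight vector. -/
def zW (k : Type) [Field k] (W : Finset V) : V → k := fun v => if v ∈ W then 1 else 0

/-- The Aomoto--Betti number `β_i(k⟨L⟩, W) = β_i(k⟨L⟩, z_W)`. -/
noncomputable def aomotoBettiW (k : Type) [Field k] (L : Finset (Finset V)) (W : Finset V)
    (i : ℕ) : ℕ :=
  aomotoBetti k L (zW k W) i

/-- The cycles in cardinality-degree `n` of the twisted chain complex `C_•(T_L, R_z)`
(in degree `0` every chain is a cycle). -/
noncomputable def cyc (R : Type) [CommRing R] (L : Finset (Finset V)) (z : V → R) :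
    (n : ℕ) → Submodule R (Face L n → R)
  | 0 => ⊤
  | (m+1) => LinearMap.ker (tB R L z m)

/-- `dim_k H_n(C_•(T_L, k_z))`, the dimension of the `n`-th twisted homology of the
toric complex `T_L` with coefficients in the rank-one system determined by `z`. -/
noncomputable def twHomDim (k : Type) [Field k] (L : Finset (Finset V)) (z : V → k)
    (n : ℕ) : ℕ :=
  Module.finrank k ↥(cyc k L z n) - Module.finrank k ↥(LinearMap.range (tB k L z n))

/-- `dim_k H̃_j(K; k)`, the `j`-th reduced simplicial homology of the complex `K`
(the chain complex of `K` including the empty face is exactly the twisted complex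
with all weights equal to `1`; the degree-`j` reduced homology sits in
cardinality-degree `j+1`). -/
noncomputable def reducedBetti (k : Type) [Field k] (K : Finset (Finset V)) (j : ℤ) : ℕ :=
  if j < -1 then 0 else twHomDim k K (fun _ => (1 : k)) (j+1).toNat

/-- The link `lk_{L_W}(σ) = {τ ∈ L_W ∣ τ ∪ σ ∈ L}` of a face `σ` in the induced
subcomplex `L_W`. -/
def linkIn (L : Finset (Finset V)) (W σ : Finset V) : Finset (Finset V) :=
  L.filter (fun τ => τ ⊆ W ∧ τ ∪ σ ∈ L)

/-- The `n`-th homology of the twisted chain complex `C_•(T_L, R_z)`, as an `R`-module. -/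
noncomputable abbrev twHomology (R : Type) [CommRing R] (L : Finset (Finset V)) (z : V → R)
    (n : ℕ) :=
  ↥(cyc R L z n) ⧸ (LinearMap.range (tB R L z n)).comap (cyc R L z n).subtype

/-- The support of `χ` in characteristic `q`: `V_q(χ) = {v ∈ V : m_v ≢ 0 mod q}`
(for `q = 0` this is `V_0(χ) = {v : m_v ≠ 0}`). -/
noncomputable def Vq {V : Type} [Fintype V] [LinearOrder V] (m : V → ℤ) (q : ℕ) :
    Finset V :=
  @Finset.filter V (fun v => ¬ ((q : ℤ) ∣ m v)) (Classical.decPred _) Finset.univ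

set_option linter.unusedSectionVars false

/-- The matrix of the twisted boundary map. -/
def bdry {R : Type} [CommRing R] (L : Finset (Finset V)) (z : V → R) (c : ℕ) :
    Matrix (Face L c) (Face L (c + 1)) R :=
  fun τ σ => coeffD z τ.1 σ.1

lemma tB_eq_mulVecLin {R : Type} [CommRing R] (L : Finset (Finset V)) (z : V → R) (c : ℕ) :
    tB R L z c = (bdry L z c).mulVecLin := rfl

lemma tB_apply {R : Type} [CommRing R] (L : Finset (Finset V)) (z : V → R) (c : ℕ)
    (x : Face L (c + 1) → R) (τ : Face L c) :
    tB R L z c x τ = ∑ σ, coeffD z τ.1 σ.1 * x σ := rfl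

lemma aD_eq_mulVecLin {k : Type} [Field k] (L : Finset (Finset V)) (z : V → k) (c : ℕ) :
    aD k L z c = (bdry L z c).transpose.mulVecLin := rfl

lemma coeffD_insert {R : Type} [CommRing R] (z : V → R) {τ : Finset V} {v : V} (hv : v ∉ τ) :
    coeffD z τ (insert v τ) = (-1 : R) ^ (τ.filter (fun w => w < v)).card * z v := by
  have h : insert v τ \ τ = {v} := by
    ext w; simp only [mem_sdiff, mem_insert, mem_singleton]
    constructor
    · rintro ⟨rfl | h, h'⟩
      · rfl
      · exact absurd h h'
    · rintro rfl; exact ⟨Or.inl rfl, hv⟩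
  rw [coeffD, if_pos (subset_insert _ _), h, sum_singleton]

lemma coeffD_of_not_subset {R : Type} [CommRing R] (z : V → R) {τ σ : Finset V}
    (h : ¬ τ ⊆ σ) : coeffD z τ σ = 0 := if_neg h

lemma exists_insert_eq {τ σ : Finset V} (h : τ ⊆ σ) (hc : σ.card = τ.card + 1) :
    ∃ v, v ∉ τ ∧ insert v τ = σ := by
  have := card_sdiff_of_subset h
  obtain ⟨v, hv⟩ := card_eq_one.1 (show (σ \ τ).card = 1 by omega)
  have hm : v ∈ σ \ τ := by simp [hv]
  rw [mem_sdiff] at hm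
  refine ⟨v, hm.2, eq_of_subset_of_card_le (insert_subset hm.1 h) ?_⟩
  rw [card_insert_of_notMem hm.2, hc]

lemma map_coeffD {R S : Type} [CommRing R] [CommRing S] (φ : R →+* S) (z : V → R)
    (τ σ : Finset V) : φ (coeffD z τ σ) = coeffD (fun v => φ (z v)) τ σ := by
  simp only [coeffD, apply_ite φ, map_sum, map_mul, map_pow, map_neg, map_one, map_zero]

lemma map_bdry {R S : Type} [CommRing R] [CommRing S] (φ : R →+* S) (L : Finset (Finset V))
    (z : V → R) (c : ℕ) : (bdry L z c).map φ = bdry L (fun v => φ (z v)) c := by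
  ext τ σ; exact map_coeffD φ z _ _

lemma map_tB {R S : Type} [CommRing R] [CommRing S] (φ : R →+* S) (L : Finset (Finset V))
    (z : V → R) (c : ℕ) (x : Face L (c + 1) → R) (τ : Face L c) :
    φ (tB R L z c x τ) = tB S L (fun v => φ (z v)) c (fun σ => φ (x σ)) τ := by
  simp only [tB_apply, map_sum, map_mul, map_coeffD]

lemma coeffD_mul_coeffD_add {R : Type} [CommRing R] (z : V → R) {τ : Finset V} {a b : V}
    (ha : a ∉ τ) (hb : b ∉ τ) (hab : a < b) :
    coeffD z τ (insert a τ) * coeffD z (insert a τ) (insert b (insert a τ)) +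
      coeffD z τ (insert b τ) * coeffD z (insert b τ) (insert a (insert b τ)) = 0 := by
  rw [coeffD_insert z ha, coeffD_insert z hb,
    coeffD_insert z (show b ∉ insert a τ by simp [hab.ne', hb]),
    coeffD_insert z (show a ∉ insert b τ by simp [hab.ne, ha]),
    filter_insert, filter_insert, if_pos hab, if_neg hab.not_gt,
    card_insert_of_notMem (by simp [ha])]
  ring

lemma bdry_mul_bdry {R : Type} [CommRing R] {L : Finset (Finset V)} (hL : IsCx L) (z : V → R)
    (c : ℕ) : bdry L z c * bdry L z (c + 1) = 0 := by
  ext τ ρ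
  rw [Matrix.mul_apply, Matrix.zero_apply]
  change ∑ σ : Face L (c + 1), coeffD z τ.1 σ.1 * coeffD z σ.1 ρ.1 = 0
  have key : ∀ a b : V, a < b → a ∉ τ.1 → b ∉ τ.1 → insert b (insert a τ.1) = ρ.1 →
      ∑ σ : Face L (c + 1), coeffD z τ.1 σ.1 * coeffD z σ.1 ρ.1 = 0 := by
    intro a b hab ha hb hρ
    have hρ' : insert a (insert b τ.1) = ρ.1 := by rw [← hρ, insert_comm]
    let A : Face L (c + 1) := ⟨insert a τ.1, hL.2 _ ρ.2.1 _ (by rw [← hρ]; exact subset_insert _ _),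
      by rw [card_insert_of_notMem ha, τ.2.2]⟩
    let B : Face L (c + 1) := ⟨insert b τ.1, hL.2 _ ρ.2.1 _ (by rw [← hρ']; exact subset_insert _ _),
      by rw [card_insert_of_notMem hb, τ.2.2]⟩
    have hAB : A ≠ B := by
      intro h
      have h1 : a ∈ insert b τ.1 := by
        rw [← show insert a τ.1 = insert b τ.1 from congrArg Subtype.val h]
        exact mem_insert_self _ _
      rcases mem_insert.1 h1 with h1 | h1
      · exact hab.ne h1
      · exact ha h1
    rw [Fintype.sum_eq_add A B hAB]
    · have := coeffD_mul_coeffD_add z ha hb hab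
      rwa [hρ, hρ'] at this
    · rintro σ ⟨hA, hB⟩
      by_cases h1 : τ.1 ⊆ σ.1
      swap
      · rw [coeffD_of_not_subset z h1, zero_mul]
      by_cases h2 : σ.1 ⊆ ρ.1
      swap
      · rw [coeffD_of_not_subset z h2, mul_zero]
      obtain ⟨v, hv, hvσ⟩ := exists_insert_eq h1 (by rw [σ.2.2, τ.2.2])
      have hvρ : v ∈ ρ.1 := h2 (by rw [← hvσ]; exact mem_insert_self _ _)
      rw [← hρ, mem_insert, mem_insert] at hvρ
      rcases hvρ with rfl | rfl | h
      · exact absurd (Subtype.ext hvσ.symm) hB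
      · exact absurd (Subtype.ext hvσ.symm) hA
      · exact absurd h hv
  by_cases hτρ : τ.1 ⊆ ρ.1
  · have h2 : (ρ.1 \ τ.1).card = 2 := by
      rw [card_sdiff_of_subset hτρ, ρ.2.2, τ.2.2]; omega
    obtain ⟨a, b, hab, hρ⟩ := card_eq_two.1 h2
    have ha : a ∈ ρ.1 \ τ.1 := by simp [hρ]
    have hb : b ∈ ρ.1 \ τ.1 := by simp [hρ]
    have hun : insert b (insert a τ.1) = ρ.1 := by
      rw [← sdiff_union_of_subset hτρ, hρ]; ext; simp; tauto
    rcases lt_or_gt_of_ne hab with h | h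
    · exact key a b h (mem_sdiff.1 ha).2 (mem_sdiff.1 hb).2 hun
    · exact key b a h (mem_sdiff.1 hb).2 (mem_sdiff.1 ha).2 (by rw [insert_comm, hun])
  · refine sum_eq_zero fun σ _ => ?_
    by_cases h1 : τ.1 ⊆ σ.1
    · rw [coeffD_of_not_subset (τ := σ.1) z fun h2 => hτρ (h1.trans h2), mul_zero]
    · rw [coeffD_of_not_subset z h1, zero_mul]

lemma tB_tB {R : Type} [CommRing R] {L : Finset (Finset V)} (hL : IsCx L) (z : V → R)
    (c : ℕ) (x : Face L (c + 2) → R) : tB R L z c (tB R L z (c + 1) x) = 0 := by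
  rw [tB_eq_mulVecLin, tB_eq_mulVecLin, Matrix.mulVecLin_apply, Matrix.mulVecLin_apply,
    Matrix.mulVec_mulVec, bdry_mul_bdry hL, Matrix.zero_mulVec]

lemma range_tB_le_cyc {R : Type} [CommRing R] {L : Finset (Finset V)} (hL : IsCx L) (z : V → R)
    (n : ℕ) : LinearMap.range (tB R L z n) ≤ cyc R L z n := by
  rintro _ ⟨x, rfl⟩
  cases n with
  | zero => trivial
  | succ n => exact tB_tB hL z n x

lemma mem_cyc_map {R S : Type} [CommRing R] [CommRing S] (φ : R →+* S) (L : Finset (Finset V))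
    (z : V → R) {n : ℕ} {x : Face L n → R} (hx : x ∈ cyc R L z n) :
    (fun σ => φ (x σ)) ∈ cyc S L (fun v => φ (z v)) n := by
  cases n with
  | zero => trivial
  | succ n =>
    change tB _ _ _ _ _ = 0
    ext τ
    rw [← map_tB, show tB R L z n x = 0 from hx]
    simp

lemma Matrix.rank_add_le_rank_add_rank {m n : Type} [Fintype m] [Fintype n] {K : Type}
    [Field K] (A B : Matrix m n K) : (A + B).rank ≤ A.rank + B.rank := by
  rw [Matrix.rank, Matrix.rank, Matrix.rank, Matrix.mulVecLin_add]
  refine (Submodule.finrank_mono (LinearMap.range_add_le _ _)).trans ?_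
  exact Submodule.finrank_add_le_finrank_add_finrank _ _

lemma Matrix.exists_rank_factorization {m n : Type} [Fintype m] [Fintype n]
    {K : Type} [Field K] (A : Matrix m n K) :
    ∃ (B : Matrix m (Fin A.rank) K) (C : Matrix (Fin A.rank) n K)
      (B' : Matrix (Fin A.rank) m K) (C' : Matrix n (Fin A.rank) K),
      A = B * C ∧ B' * B = 1 ∧ C * C' = 1 := by
  classical
  let e : LinearMap.range A.mulVecLin ≃ₗ[K] (Fin A.rank → K) :=
    LinearEquiv.ofFinrankEq _ _ (by rw [Module.finrank_fin_fun]; rfl)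
  let b : (Fin A.rank → K) →ₗ[K] (m → K) :=
    (LinearMap.range A.mulVecLin).subtype ∘ₗ e.symm.toLinearMap
  let c : (n → K) →ₗ[K] (Fin A.rank → K) := e.toLinearMap ∘ₗ A.mulVecLin.rangeRestrict
  obtain ⟨b', hb'⟩ := b.exists_leftInverse_of_injective (LinearMap.ker_eq_bot.2
    (Subtype.val_injective.comp e.symm.injective))
  obtain ⟨c', hc'⟩ := c.exists_rightInverse_of_surjective (LinearMap.range_eq_top.2
    (e.surjective.comp A.mulVecLin.surjective_rangeRestrict))
  refine ⟨b.toMatrix', c.toMatrix', b'.toMatrix', c'.toMatrix', ?_, ?_, ?_⟩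
  · rw [← LinearMap.toMatrix'_comp]
    have : b ∘ₗ c = A.mulVecLin := by
      ext x; simp [b, c]
    rw [this, ← Matrix.toLin'_apply', LinearMap.toMatrix'_toLin']
  · rw [← LinearMap.toMatrix'_comp, hb', LinearMap.toMatrix'_id]
  · rw [← LinearMap.toMatrix'_comp, hc', LinearMap.toMatrix'_id]

lemma Matrix.rank_map_ringHom {m n : Type} [Fintype m] [Fintype n] {K F : Type} [Field K]
    [Field F] (φ : K →+* F) (A : Matrix m n K) : (A.map φ).rank = A.rank := by
  obtain ⟨B, C, B', C', hA, hB, hC⟩ := A.exists_rank_factorization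
  apply le_antisymm
  · calc (A.map φ).rank = (B.map φ * C.map φ).rank := by rw [← Matrix.map_mul, ← hA]
      _ ≤ (B.map φ).rank := Matrix.rank_mul_le_left _ _
      _ ≤ A.rank := by simpa using (B.map φ).rank_le_card_width
  · have hAC : A * C' = B := by
      conv_lhs => arg 1; rw [hA]
      rw [Matrix.mul_assoc, hC, Matrix.mul_one]
    have h1 : B'.map φ * (A.map φ * C'.map φ) = 1 := by
      rw [← Matrix.map_mul, ← Matrix.map_mul, hAC, hB,
        Matrix.map_one φ (map_zero φ) (map_one φ)]
    have h2 : (1 : Matrix (Fin A.rank) (Fin A.rank) F).rank ≤ (A.map φ).rank := by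
      rw [← h1]
      exact (Matrix.rank_mul_le_right _ _).trans (Matrix.rank_mul_le_left _ _)
    simpa using h2

lemma coeffD_eq_of_support {K : Type} [Field K] {z z' : V → K} (h : ∀ v, z v = 0 ↔ z' v = 0) :
    ∃ u : V → K, (∀ v, u v ≠ 0) ∧ ∀ (τ σ : Finset V), σ.card = τ.card + 1 →
      (∏ v ∈ τ, u v) * coeffD z τ σ = coeffD z' τ σ * ∏ v ∈ σ, u v := by
  classical
  refine ⟨fun v => if z v = 0 then 1 else z v / z' v, fun v => ?_, fun τ σ hc => ?_⟩
  · dsimp only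
    split_ifs with h0
    · exact one_ne_zero
    · exact div_ne_zero h0 (fun h' => h0 ((h v).2 h'))
  · by_cases hs : τ ⊆ σ
    · obtain ⟨v, hv, rfl⟩ := exists_insert_eq hs hc
      rw [coeffD_insert z hv, coeffD_insert z' hv, prod_insert hv]
      by_cases h0 : z v = 0
      · rw [h0, (h v).1 h0]; ring
      · have h1 : z' v ≠ 0 := fun h' => h0 ((h v).2 h')
        rw [if_neg h0]
        field_simp
    · rw [coeffD_of_not_subset z hs, coeffD_of_not_subset z' hs, mul_zero, zero_mul]

lemma rank_bdry_eq_of_support {K : Type} [Field K] (L : Finset (Finset V)) {z z' : V → K}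
    (h : ∀ v, z v = 0 ↔ z' v = 0) (c : ℕ) : (bdry L z c).rank = (bdry L z' c).rank := by
  obtain ⟨u, hu, hz⟩ := coeffD_eq_of_support h
  let U (n : ℕ) : Matrix (Face L n) (Face L n) K := Matrix.diagonal fun σ => ∏ v ∈ σ.1, u v
  have hU : ∀ n, (U n).det ≠ 0 := fun n => by
    rw [Matrix.det_diagonal]
    exact prod_ne_zero_iff.2 fun σ _ => prod_ne_zero_iff.2 fun v _ => hu v
  have : U c * bdry L z c = bdry L z' c * U (c + 1) := by
    ext τ σ
    rw [Matrix.diagonal_mul, Matrix.mul_diagonal]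
    exact hz τ.1 σ.1 (by rw [σ.2.2, τ.2.2])
  rw [← Matrix.rank_mul_eq_right_of_isUnit_det (U c) _ (hU c).isUnit, this,
    Matrix.rank_mul_eq_left_of_isUnit_det _ _ (hU (c + 1)).isUnit]

lemma rank_bdry_eq_of_ringHom {K F : Type} [Field K] [Field F] (φ : K →+* F)
    (L : Finset (Finset V)) {z : V → K} {z' : V → F} (h : ∀ v, z v = 0 ↔ z' v = 0) (c : ℕ) :
    (bdry L z c).rank = (bdry L z' c).rank := by
  rw [← Matrix.rank_map_ringHom φ, map_bdry]
  exact rank_bdry_eq_of_support L (fun v => by rw [map_eq_zero, h v]) c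

/-- The rank inequality expressing exactness of the twisted complex in degree `n`. -/
def RankExact {K : Type} [Field K] (L : Finset (Finset V)) (z : V → K) : ℕ → Prop
  | 0 => Fintype.card (Face L 0) ≤ (bdry L z 0).rank
  | n + 1 => Fintype.card (Face L (n + 1)) ≤ (bdry L z (n + 1)).rank + (bdry L z n).rank

lemma rankExact_iff_of_ringHom {K F : Type} [Field K] [Field F] (φ : K →+* F)
    (L : Finset (Finset V)) {z : V → K} {z' : V → F} (h : ∀ v, z v = 0 ↔ z' v = 0) (n : ℕ) :
    RankExact L z n ↔ RankExact L z' n := by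
  cases n <;> simp only [RankExact, rank_bdry_eq_of_ringHom φ L h]

lemma aomotoBetti_eq_zero_iff {k : Type} [Field k] (L : Finset (Finset V)) (z : V → k) (n : ℕ) :
    aomotoBetti k L z n = 0 ↔ RankExact L z n := by
  have h1 : ∀ c, Module.finrank k (LinearMap.range (aD k L z c)) = (bdry L z c).rank := fun c => by
    rw [aD_eq_mulVecLin, ← Matrix.rank_transpose]; rfl
  have h2 := LinearMap.finrank_range_add_finrank_ker (aD k L z n)
  rw [h1, Module.finrank_fintype_fun_eq_card] at h2
  cases n with
  | zero => simp only [aomotoBetti, RankExact]; omega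
  | succ n => simp only [aomotoBetti, RankExact, h1]; omega

lemma RankExact.cyc_le_range {K : Type} [Field K] {L : Finset (Finset V)} (hL : IsCx L)
    {z : V → K} {n : ℕ} (h : RankExact L z n) :
    cyc K L z n ≤ LinearMap.range (tB K L z n) := by
  refine (Submodule.eq_of_le_of_finrank_le (range_tB_le_cyc hL z n) ?_).ge
  have h1 : ∀ c, Module.finrank K (LinearMap.range (tB K L z c)) = (bdry L z c).rank :=
    fun c => rfl
  rw [h1]
  cases n with
  | zero =>
    refine le_trans ?_ h
    rw [← Module.finrank_fintype_fun_eq_card K]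
    exact Submodule.finrank_le _
  | succ n =>
    have h2 := LinearMap.finrank_range_add_finrank_ker (tB K L z n)
    rw [h1, Module.finrank_fintype_fun_eq_card] at h2
    change Module.finrank K (LinearMap.ker (tB K L z n)) ≤ _
    simp only [RankExact] at h
    omega

section Exactness

variable {R : Type} [CommRing R]

lemma exists_lift_of_cyc_le_range {L : Finset (Finset V)} {z : V → R} {n : ℕ}
    (h : cyc R L z n ≤ LinearMap.range (tB R L z n))
    (P : (Face L n → R) →ₗ[R] (Face L n → R)) (hP : ∀ x, P x ∈ cyc R L z n) :
    ∃ s : (Face L n → R) →ₗ[R] (Face L (n + 1) → R), ∀ x, tB R L z n (s x) = P x := by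
  obtain ⟨s, hs⟩ := Module.projective_lifting_property (tB R L z n).rangeRestrict
    (P.codRestrict _ fun x => h (hP x)) (tB R L z n).surjective_rangeRestrict
  exact ⟨s, fun x => congrArg Subtype.val (LinearMap.congr_fun hs x)⟩

/-- Partial contracting homotopies in degree `n`. -/
def HasContraction (L : Finset (Finset V)) (z : V → R) : ℕ → Prop
  | 0 => ∃ s : (Face L 0 → R) →ₗ[R] (Face L 1 → R), ∀ x, tB R L z 0 (s x) = x
  | n + 1 => ∃ (s : (Face L n → R) →ₗ[R] (Face L (n + 1) → R))
      (s' : (Face L (n + 1) → R) →ₗ[R] (Face L (n + 2) → R)),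
      ∀ x, tB R L z (n + 1) (s' x) + s (tB R L z n x) = x

lemma HasContraction.exists_section {L : Finset (Finset V)} {z : V → R} {n : ℕ}
    (h : HasContraction L z n) : ∃ s : (Face L n → R) →ₗ[R] (Face L (n + 1) → R),
      ∀ x ∈ cyc R L z n, tB R L z n (s x) = x := by
  cases n with
  | zero => exact h.imp fun s hs x _ => hs x
  | succ n =>
    obtain ⟨s, s', hs⟩ := h
    refine ⟨s', fun x hx => ?_⟩
    have := hs x
    rwa [show tB R L z n x = 0 from hx, map_zero, add_zero] at this

lemma sub_section_mem_cyc {L : Finset (Finset V)} (hL : IsCx L) {z : V → R} {n : ℕ}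
    {s : (Face L n → R) →ₗ[R] (Face L (n + 1) → R)}
    (hs : ∀ x ∈ cyc R L z n, tB R L z n (s x) = x) (x : Face L (n + 1) → R) :
    (LinearMap.id - s ∘ₗ tB R L z n : (Face L (n + 1) → R) →ₗ[R] (Face L (n + 1) → R)) x ∈
      cyc R L z (n + 1) := by
  change tB R L z n (x - s (tB R L z n x)) = 0
  rw [map_sub, hs _ (range_tB_le_cyc hL z n ⟨x, rfl⟩), sub_self]

lemma hasContraction_of_cyc_le_range {L : Finset (Finset V)} (hL : IsCx L) {z : V → R} {n : ℕ}
    (h : ∀ i ≤ n, cyc R L z i ≤ LinearMap.range (tB R L z i)) : HasContraction L z n := by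
  induction n with
  | zero => exact exists_lift_of_cyc_le_range (h 0 le_rfl) LinearMap.id fun _ => trivial
  | succ n ih =>
    obtain ⟨s, hs⟩ := (ih fun i hi => h i (hi.trans n.le_succ)).exists_section
    obtain ⟨s', hs'⟩ := exists_lift_of_cyc_le_range (h (n + 1) le_rfl) _
      (sub_section_mem_cyc hL hs)
    exact ⟨s, s', fun x => by rw [hs']; simp⟩

lemma exists_projection_cyc {L : Finset (Finset V)} (hL : IsCx L) {z : V → R} {n : ℕ}
    (h : ∀ i < n, cyc R L z i ≤ LinearMap.range (tB R L z i)) :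
    ∃ P : (Face L n → R) →ₗ[R] (Face L n → R),
      (∀ x, P x ∈ cyc R L z n) ∧ ∀ x ∈ cyc R L z n, P x = x := by
  cases n with
  | zero => exact ⟨LinearMap.id, fun _ => trivial, fun _ _ => rfl⟩
  | succ n =>
    obtain ⟨s, hs⟩ := (hasContraction_of_cyc_le_range hL
      fun i hi => h i (Nat.lt_succ_of_le hi)).exists_section
    refine ⟨_, sub_section_mem_cyc hL hs, fun x hx => ?_⟩
    simp [show tB R L z n x = 0 from hx]

lemma HasContraction.rankExact {K : Type} [Field K] {L : Finset (Finset V)} {z : V → R}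
    {n : ℕ} (h : HasContraction L z n) (φ : R →+* K) :
    RankExact L (fun v => φ (z v)) n := by
  classical
  cases n with
  | zero =>
    obtain ⟨s, hs⟩ := h
    have h1 : bdry L z 0 * s.toMatrix' = 1 := by
      rw [← LinearMap.toMatrix'_toLin' (bdry L z 0), ← LinearMap.toMatrix'_comp,
        ← LinearMap.toMatrix'_id]
      congr 1
      exact LinearMap.ext hs
    have h2 := congrArg (fun M => Matrix.map M φ) h1
    simp only [Matrix.map_mul, map_bdry, Matrix.map_one φ (map_zero φ) (map_one φ)] at h2
    simp only [RankExact]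
    rw [← Matrix.rank_one (n := Face L 0) (R := K), ← h2]
    exact Matrix.rank_mul_le_left _ _
  | succ n =>
    obtain ⟨s, s', hs⟩ := h
    have h1 : bdry L z (n + 1) * s'.toMatrix' + s.toMatrix' * bdry L z n = 1 := by
      rw [← LinearMap.toMatrix'_toLin' (bdry L z (n + 1)),
        ← LinearMap.toMatrix'_toLin' (bdry L z n), ← LinearMap.toMatrix'_comp,
        ← LinearMap.toMatrix'_comp, ← map_add, ← LinearMap.toMatrix'_id]
      congr 1
      exact LinearMap.ext hs
    have h2 := congrArg (fun M => Matrix.map M φ) h1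
    simp only [Matrix.map_add φ (map_add φ), Matrix.map_mul, map_bdry,
      Matrix.map_one φ (map_zero φ) (map_one φ)] at h2
    simp only [RankExact]
    rw [← Matrix.rank_one (n := Face L (n + 1)) (R := K), ← h2]
    exact (Matrix.rank_add_le_rank_add_rank _ _).trans
      (add_le_add (Matrix.rank_mul_le_left _ _) (Matrix.rank_mul_le_right _ _))

lemma Submodule.le_of_forall_isMaximal_le_sup_smul {M : Type} [AddCommGroup M] [Module R M]
    {N N' : Submodule R M} (hN : N.FG)
    (h : ∀ I : Ideal R, I.IsMaximal → N ≤ N' ⊔ I • N) : N ≤ N' := by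
  by_contra hcon
  have hJ : N'.colon (N : Set M) ≠ ⊤ := fun hJ => hcon fun x hx => by
    have h1 : (1 : R) ∈ N'.colon (N : Set M) := hJ ▸ Submodule.mem_top
    simpa using Submodule.mem_colon.1 h1 x hx
  obtain ⟨I, hI, hJI⟩ := Ideal.exists_le_maximal _ hJ
  obtain ⟨a, ha, haN⟩ := Submodule.exists_sub_one_mem_and_smul_eq_zero_of_fg_of_le_smul I
    (N.map N'.mkQ) (hN.map _) (by
      have := Submodule.map_mono (f := N'.mkQ) (h I hI)
      rwa [Submodule.map_sup, Submodule.map_smul'', Submodule.mkQ_map_self, bot_sup_eq] at this)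
  have haJ : a ∈ N'.colon (N : Set M) := Submodule.mem_colon.2 fun x hx => by
    have := haN _ (Submodule.mem_map_of_mem hx)
    rwa [← map_smul, Submodule.mkQ_apply, Submodule.Quotient.mk_eq_zero] at this
  refine hI.ne_top ((Ideal.eq_top_iff_one _).2 ?_)
  simpa using I.sub_mem (hJI haJ) ha

lemma cyc_le_range_of_rankExact {L : Finset (Finset V)} (hL : IsCx L) {z : V → R} {r : ℕ}
    (h : ∀ (K : Type) [Field K] (φ : R →+* K), Function.Surjective φ →
      ∀ i ≤ r, RankExact L (fun v => φ (z v)) i) :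
    ∀ i ≤ r, cyc R L z i ≤ LinearMap.range (tB R L z i) := by
  classical
  intro n
  induction n using Nat.strong_induction_on with
  | _ n ih =>
  intro hn
  obtain ⟨P, hPmem, hP⟩ := exists_projection_cyc hL fun i hi => ih i hi (hi.le.trans hn)
  refine Submodule.le_of_forall_isMaximal_le_sup_smul ?_ fun I hI x hx => ?_
  · have : cyc R L z n = LinearMap.range P :=
      le_antisymm (fun x hx => ⟨x, hP x hx⟩) (by rintro _ ⟨x, rfl⟩; exact hPmem x)
    rw [this, LinearMap.range_eq_map]
    exact Module.Finite.fg_top.map P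
  · let _ := Ideal.Quotient.field I
    obtain ⟨y, hy⟩ := (h (R ⧸ I) (Ideal.Quotient.mk I) Ideal.Quotient.mk_surjective n hn).cyc_le_range
      hL (mem_cyc_map (Ideal.Quotient.mk I) L z hx)
    choose y' hy' using fun σ => Ideal.Quotient.mk_surjective (y σ)
    have hw : ∀ τ, (x - tB R L z n y') τ ∈ I := fun τ => by
      rw [← Ideal.Quotient.eq_zero_iff_mem, Pi.sub_apply, map_sub, map_tB, sub_eq_zero]
      simp only [hy', hy]
    have hmem : tB R L z n y' ∈ cyc R L z n := range_tB_le_cyc hL z n ⟨y', rfl⟩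
    have hxw : x = tB R L z n y' + P (x - tB R L z n y') := by
      rw [hP _ (Submodule.sub_mem _ hx hmem)]; abel
    rw [hxw]
    refine Submodule.add_mem_sup ⟨y', rfl⟩ ?_
    rw [pi_eq_sum_univ' (x - tB R L z n y'), map_sum]
    refine Submodule.sum_mem _ fun τ _ => ?_
    rw [map_smul]
    exact Submodule.smul_mem_smul (hw τ) (hPmem _)

end Exactness

lemma RankExact.mono_support {k : Type} [Field k] {L : Finset (Finset V)} (hL : IsCx L)
    {W W' : Finset V} (hW : W ⊆ W') {r : ℕ} (h : ∀ i ≤ r, RankExact L (zW k W) i) :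
    ∀ i ≤ r, RankExact L (zW k W') i := by
  let z : V → PowerSeries k :=
    fun v => if v ∈ W then 1 else if v ∈ W' then PowerSeries.X else 0
  have hz := cyc_le_range_of_rankExact hL (z := z) (r := r) fun K _ φ hφ i hi => by
    refine (rankExact_iff_of_ringHom (φ.comp PowerSeries.C) L (fun v => ?_) i).1 (h i hi)
    have hX : φ PowerSeries.X = 0 := by
      have hM : (RingHom.ker φ).IsMaximal := RingHom.ker_isMaximal_of_surjective φ hφ
      rw [← RingHom.mem_ker, IsLocalRing.eq_maximalIdeal hM, IsLocalRing.mem_maximalIdeal,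
        mem_nonunits_iff]
      exact PowerSeries.X_prime.not_isUnit
    by_cases h1 : v ∈ W <;> by_cases h2 : v ∈ W' <;> simp [zW, z, h1, h2, hX]
  intro i hi
  let ψ := algebraMap (PowerSeries k) (FractionRing (PowerSeries k))
  have hψ := (hasContraction_of_cyc_le_range hL fun j hj => hz j (hj.trans hi)).rankExact ψ
  refine (rankExact_iff_of_ringHom (ψ.comp PowerSeries.C) L (fun v => ?_) i).2 hψ
  have hX : ψ PowerSeries.X ≠ 0 := fun h0 => PowerSeries.X_ne_zero
    ((IsFractionRing.injective (PowerSeries k) (FractionRing (PowerSeries k)))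
      (h0.trans (map_zero _).symm))
  by_cases h1 : v ∈ W
  · simp [zW, z, h1, hW h1]
  · by_cases h2 : v ∈ W' <;> simp [zW, z, h1, h2, hX]

lemma coeffD_mul_left {R : Type} [CommRing R] (a : R) (z : V → R) (τ σ : Finset V) :
    coeffD (fun v => a * z v) τ σ = a * coeffD z τ σ := by
  unfold coeffD
  split_ifs
  · rw [mul_sum]
    exact sum_congr rfl fun v _ => by ring
  · rw [mul_zero]

lemma tB_mul_left {R : Type} [CommRing R] (L : Finset (Finset V)) (a : R) (z : V → R) (c : ℕ)
    (x : Face L (c + 1) → R) : tB R L (fun v => a * z v) c x = a • tB R L z c x := by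
  ext τ
  simp only [Pi.smul_apply, smul_eq_mul, tB_apply, coeffD_mul_left, mul_sum, mul_assoc]

lemma cyc_mul_left {R : Type} [CommRing R] [IsDomain R] (L : Finset (Finset V)) {a : R}
    (ha : a ≠ 0) (z : V → R) (n : ℕ) : cyc R L (fun v => a * z v) n = cyc R L z n := by
  cases n with
  | zero => rfl
  | succ n =>
    ext x
    change tB _ _ _ _ _ = 0 ↔ tB _ _ _ _ _ = 0
    rw [tB_mul_left, smul_eq_zero_iff_right ha]

lemma forall_smul_twHomology_eq_self_iff {R : Type} [CommRing R] [IsDomain R]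
    (L : Finset (Finset V)) {t : R} (ht : t - 1 ≠ 0) (z : V → R) (n : ℕ) :
    (∀ x : twHomology R L (fun v => (t - 1) * z v) n, t • x = x) ↔
      cyc R L z n ≤ LinearMap.range (tB R L z n) := by
  have h1 : ∀ x : cyc R L (fun v => (t - 1) * z v) n,
      t • (Submodule.Quotient.mk x : twHomology R L (fun v => (t - 1) * z v) n) =
        Submodule.Quotient.mk x ↔ (x : Face L n → R) ∈ LinearMap.range (tB R L z n) := by
    intro x
    rw [← Submodule.Quotient.mk_smul, Submodule.Quotient.eq, Submodule.mem_comap]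
    have h2 : (cyc R L (fun v => (t - 1) * z v) n).subtype (t • x - x) =
        (t - 1) • (x : Face L n → R) := by
      simp [sub_smul]
    rw [h2, LinearMap.mem_range, LinearMap.mem_range]
    refine exists_congr fun y => ?_
    rw [tB_mul_left]
    exact (smul_right_injective _ ht).eq_iff
  rw [← cyc_mul_left L ht z n]
  constructor
  · intro h x hx
    exact (h1 ⟨x, hx⟩).1 (h _)
  · intro h x
    obtain ⟨x, rfl⟩ := Submodule.Quotient.mk_surjective _ x
    exact (h1 x).2 (h x.2)

section Laurent

open LaurentPolynomial

lemma T_one_sub_one_ne_zero (k : Type) [Field k] : (T 1 - 1 : LaurentPolynomial k) ≠ 0 := by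
  intro h
  rw [sub_eq_zero, ← Polynomial.toLaurent_X, ← Polynomial.toLaurent_one] at h
  simpa using congrArg Polynomial.natDegree (Polynomial.toLaurent_injective h)

lemma T_one_sub_one_dvd (k : Type) [Field k] (n : ℤ) :
    (T 1 - 1 : LaurentPolynomial k) ∣ T n - 1 := by
  have h : ∀ n : ℕ, (T 1 - 1 : LaurentPolynomial k) ∣ T n - 1 := fun n => by
    simpa [T_pow] using sub_dvd_pow_sub_pow (T 1 : LaurentPolynomial k) 1 n
  obtain ⟨a, rfl | rfl⟩ := n.eq_nat_or_neg
  · exact h a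
  · have : (T (-a) - 1 : LaurentPolynomial k) = -T (-a) * (T a - 1) := by
      rw [neg_mul, mul_sub, ← T_add]; simp
    rw [this]
    exact (h a).mul_left _

/-- The quotient `(t ^ n - 1) / (t - 1)`. -/
noncomputable def quantumInt (k : Type) [Field k] (n : ℤ) : LaurentPolynomial k :=
  (T_one_sub_one_dvd k n).choose

lemma T_one_sub_one_mul_quantumInt (k : Type) [Field k] (n : ℤ) :
    (T 1 - 1) * quantumInt k n = T n - 1 := (T_one_sub_one_dvd k n).choose_spec.symm

lemma quantumInt_add (k : Type) [Field k] (a b : ℤ) :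
    quantumInt k (a + b) = quantumInt k a + T a * quantumInt k b := by
  apply mul_left_cancel₀ (T_one_sub_one_ne_zero k)
  rw [mul_add, mul_left_comm, T_one_sub_one_mul_quantumInt, T_one_sub_one_mul_quantumInt,
    T_one_sub_one_mul_quantumInt, T_add]
  ring

lemma quantumInt_one (k : Type) [Field k] : quantumInt k 1 = 1 := by
  apply mul_left_cancel₀ (T_one_sub_one_ne_zero k)
  rw [T_one_sub_one_mul_quantumInt, mul_one]

lemma map_T {k K : Type} [Field k] [Field K] (φ : LaurentPolynomial k →+* K) (n : ℤ) :
    φ (T n) = φ (T 1) ^ n := by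
  have h : ∀ n : ℕ, φ (T n) = φ (T 1) ^ n := fun n => by rw [← map_pow, T_pow]; simp
  obtain ⟨a, rfl | rfl⟩ := n.eq_nat_or_neg
  · rw [h, zpow_natCast]
  · have h1 : φ (T (-a)) * φ (T a) = 1 := by rw [← map_mul, ← T_add]; simp
    rw [zpow_neg, zpow_natCast, ← h]
    exact eq_inv_of_mul_eq_one_left h1

lemma map_T_one_ne_zero {k K : Type} [Field k] [Field K] (φ : LaurentPolynomial k →+* K) :
    φ (T 1) ≠ 0 := ((isUnit_T 1).map φ).ne_zero

lemma map_quantumInt_eq_zero_iff {k K : Type} [Field k] [Field K]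
    (φ : LaurentPolynomial k →+* K) (h : φ (T 1) ≠ 1) (n : ℤ) :
    φ (quantumInt k n) = 0 ↔ φ (T 1) ^ n = 1 := by
  have h1 := congrArg φ (T_one_sub_one_mul_quantumInt k n)
  rw [map_mul, map_sub, map_sub, map_one, map_T φ n] at h1
  rw [← sub_eq_zero (b := (1 : K)), ← h1, mul_eq_zero, or_iff_right (sub_ne_zero.2 h)]

lemma map_quantumInt_of_map_T {k K : Type} [Field k] [Field K]
    (φ : LaurentPolynomial k →+* K) (h : φ (T 1) = 1) (n : ℤ) : φ (quantumInt k n) = n := by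
  let f : ℤ →+ K := AddMonoidHom.mk' (fun n => φ (quantumInt k n)) fun a b => by
    rw [quantumInt_add, map_add, map_mul, map_T φ a, h, one_zpow, one_mul]
  have hf : f = Int.castAddHom K := AddMonoidHom.ext_int (by
    change φ (quantumInt k 1) = ((1 : ℤ) : K)
    rw [quantumInt_one, map_one, Int.cast_one])
  exact DFunLike.congr_fun hf n

end Laurent

lemma mem_Vq {m : V → ℤ} {q : ℕ} {v : V} : v ∈ Vq m q ↔ ¬ (q : ℤ) ∣ m v := by
  simp [Vq]

lemma Vq_nonempty {m : V → ℤ} (hgcd : Finset.univ.gcd m = 1) {q : ℕ} (hq : q ≠ 1) :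
    (Vq m q).Nonempty := by
  by_contra h
  have h1 : (q : ℤ) ∣ Finset.univ.gcd m := Finset.dvd_gcd fun _ _ => by
    by_contra hv
    exact h ⟨_, mem_Vq.2 hv⟩
  rw [hgcd] at h1
  exact hq (by exact_mod_cast Int.eq_one_of_dvd_one (by positivity) h1)

lemma Vq_subset_of_dvd (m : V → ℤ) {a b : ℕ} (h : a ∣ b) : Vq m a ⊆ Vq m b := fun _ hv =>
  mem_Vq.2 fun hb => mem_Vq.1 hv ((Int.natCast_dvd_natCast.2 h).trans hb)

lemma rankExact_zero {K : Type} [Field K] {L : Finset (Finset V)} (hL : IsCx L)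
    {z : V → K} {v : V} (hvL : {v} ∈ L) (hv : z v ≠ 0) : RankExact L z 0 := by
  have h0 : Fintype.card (Face L 0) ≤ 1 := Fintype.card_le_one_iff.2 fun a b =>
    Subtype.ext ((card_eq_zero.1 a.2.2).trans (card_eq_zero.1 b.2.2).symm)
  refine h0.trans (Nat.one_le_iff_ne_zero.2 fun h => hv ?_)
  have hb : bdry L z 0 = 0 := by
    have := Submodule.finrank_eq_zero.1 h
    rw [LinearMap.range_eq_bot] at this
    classical
    rw [← LinearMap.toMatrix'_toLin' (bdry L z 0), Matrix.toLin'_apply', this, map_zero]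
  have h1 := congrFun (congrFun hb ⟨∅, hL.1, rfl⟩) ⟨{v}, hvL, card_singleton v⟩
  have h2 : coeffD z ∅ {v} = 0 := h1
  rw [← insert_empty_eq, coeffD_insert z (notMem_empty v)] at h2
  simpa using h2

lemma rankExact_zW_of_aomotoBettiW {k : Type} [Field k] {L : Finset (Finset V)} (hL : IsCx L)
    (hV : ∀ v : V, {v} ∈ L) {W : Finset V} (hW : W.Nonempty) {r : ℕ}
    (h : ∀ i : ℕ, 1 ≤ i → i ≤ r → aomotoBettiW k L W i = 0) :
    ∀ i ≤ r, RankExact L (zW k W) i := by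
  intro i hi
  cases i with
  | zero =>
    obtain ⟨v, hv⟩ := hW
    exact rankExact_zero hL (hV v) (by simp [zW, hv])
  | succ i => exact (aomotoBetti_eq_zero_iff L _ _).1 (h _ i.succ_pos hi)

open LaurentPolynomial in
/-- trivial monodromy test.  Let `char k = p`, and let
`γ_v = t^{m_v} − 1`, with `gcd(m_v) = 1`.  The `k[t,t⁻¹]`-modules
`H_i(T_L^χ; k) = H_i(C_•(T_L, Λ_γ))` have trivial `ℤ`-action (`t ⬝ x = x`) for all
`i ≤ r` if and only if
`(†)`: `β_i(k⟨L⟩, V_p(χ)) = 0` for `1 ≤ i ≤ r`, and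
`(‡)`: `β_i(k⟨L⟩, V_q(χ)) = 0` for `1 ≤ i ≤ r`, for every prime `q ≠ p` in
`P(χ) = {q : V_q(χ) ⊊ V_0(χ)}` (the primes dividing some nonzero weight). -/
theorem statement16 {V : Type} [Fintype V] [LinearOrder V] (k : Type) [Field k]
    (p : ℕ) [CharP k p]
    (L : Finset (Finset V)) (hL : IsCx L) (hV : ∀ v : V, {v} ∈ L)
    (m : V → ℤ) (hgcd : Finset.univ.gcd m = 1) (r : ℕ) (hr : 1 ≤ r) :
    (∀ i ≤ r, ∀ x : twHomology (LaurentPolynomial k) L (fun v => T (m v) - 1) i,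
        (T 1 : LaurentPolynomial k) • x = x) ↔
      ((∀ i : ℕ, 1 ≤ i → i ≤ r → aomotoBettiW k L (Vq m p) i = 0) ∧
       (∀ q : ℕ, q.Prime → q ≠ p → Vq m q ⊂ Vq m 0 →
          ∀ i : ℕ, 1 ≤ i → i ≤ r → aomotoBettiW k L (Vq m q) i = 0)) := by
  have key : ∀ i, (∀ x : twHomology (LaurentPolynomial k) L (fun v => T (m v) - 1) i,
      (T 1 : LaurentPolynomial k) • x = x) ↔
      cyc _ L (fun v => quantumInt k (m v)) i ≤
        LinearMap.range (tB _ L (fun v => quantumInt k (m v)) i) := fun i => by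
    have h := forall_smul_twHomology_eq_self_iff L (T_one_sub_one_ne_zero k)
      (fun v => quantumInt k (m v)) i
    rwa [show (fun v => (T 1 - 1) * quantumInt k (m v)) = fun v => T (m v) - 1 from
      funext fun v => T_one_sub_one_mul_quantumInt k (m v)] at h
  refine (forall₂_congr fun i _ => key i).trans ?_
  constructor
  · intro h
    have hrank : ∀ (K : Type) [Field K] (ζ : Kˣ) (f : k →+* K) (i : ℕ), i ≤ r →
        RankExact L (fun v => eval₂ f ζ (quantumInt k (m v))) i := fun K _ ζ f i hi =>
      (hasContraction_of_cyc_le_range hL fun j hj => h j (hj.trans hi)).rankExact _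
    refine ⟨fun i _ hi => ?_, fun q hq hqp _ i _ hi => ?_⟩
    · refine (aomotoBetti_eq_zero_iff L _ _).2 ((rankExact_iff_of_ringHom (RingHom.id k) L
        (fun v => ?_) i).2 (hrank k 1 (RingHom.id k) i hi))
      rw [map_quantumInt_of_map_T _ (by simp), CharP.intCast_eq_zero_iff k p]
      simp [zW, mem_Vq]
    · have hq0 : (q : k) ≠ 0 := fun h0 => by
        have h1 := (CharP.cast_eq_zero_iff k p q).1 h0
        rcases (Nat.dvd_prime hq).1 h1 with h2 | h2
        · exact CharP.char_ne_one k p h2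
        · exact hqp h2.symm
      have : NeZero (q : AlgebraicClosure k) :=
        ⟨fun h0 => hq0 ((algebraMap k (AlgebraicClosure k)).injective (by simpa using h0))⟩
      obtain ⟨ζ, hζ⟩ := HasEnoughRootsOfUnity.exists_primitiveRoot (AlgebraicClosure k) q
      refine (aomotoBetti_eq_zero_iff L _ _).2 ((rankExact_iff_of_ringHom
        (algebraMap k (AlgebraicClosure k)) L (fun v => ?_) i).2
        (hrank _ (Units.mk0 ζ (hζ.ne_zero hq.ne_zero)) (algebraMap k (AlgebraicClosure k)) i hi))
      rw [map_quantumInt_eq_zero_iff _ (by simpa using hζ.ne_one hq.one_lt)]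
      simp [zW, mem_Vq, hζ.zpow_eq_one_iff_dvd]
  · rintro ⟨hp, hq⟩
    have hp' := rankExact_zW_of_aomotoBettiW hL hV (Vq_nonempty hgcd (CharP.char_ne_one k p)) hp
    refine cyc_le_range_of_rankExact hL fun K _ φ _ i hi => ?_
    have : CharP K p := charP_of_injective_ringHom (φ.comp C).injective p
    by_cases hT : φ (T 1) = 1
    · refine (rankExact_iff_of_ringHom (φ.comp C) L (fun v => ?_) i).1 (hp' i hi)
      rw [map_quantumInt_of_map_T φ hT, CharP.intCast_eq_zero_iff K p]
      simp [zW, mem_Vq]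
    · let u : Kˣ := Units.mk0 _ (map_T_one_ne_zero φ)
      have hn1 : orderOf u ≠ 1 := fun h1 =>
        hT (by simpa [u] using congrArg Units.val (orderOf_eq_one_iff.1 h1))
      suffices hn : ∀ i ≤ r, RankExact L (zW k (Vq m (orderOf u))) i by
        refine (rankExact_iff_of_ringHom (φ.comp C) L (fun v => ?_) i).1 (hn i hi)
        rw [map_quantumInt_eq_zero_iff φ hT]
        have : φ (T 1) ^ m v = 1 ↔ u ^ m v = 1 := by
          rw [← Units.val_inj, Units.val_zpow_eq_zpow_val]; rfl
        rw [this, ← orderOf_dvd_iff_zpow_eq_one]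
        simp [zW, mem_Vq]
      obtain ⟨q, hqprime, hqn⟩ := Nat.exists_prime_and_dvd hn1
      by_cases hqp : q = p
      · exact RankExact.mono_support hL (Vq_subset_of_dvd m (hqp ▸ hqn)) hp'
      by_cases hs : Vq m q ⊂ Vq m 0
      · exact (rankExact_zW_of_aomotoBettiW hL hV (Vq_nonempty hgcd hqprime.ne_one)
          (hq q hqprime hqp hs)) |> RankExact.mono_support hL (Vq_subset_of_dvd m hqn)
      · refine RankExact.mono_support hL ?_ hp'
        have h0 : Vq m 0 ⊆ Vq m q := by
          by_contra h0
          exact hs ⟨Vq_subset_of_dvd m (dvd_zero q), h0⟩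
        exact (Vq_subset_of_dvd m (dvd_zero p)).trans (h0.trans (Vq_subset_of_dvd m hqn))
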